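/- arXiv:2310.06324 — 4 statements merged into one kernel-verified Lean document; each statement's English description precedes it below -/
import Mathlib

section
/- Let n ≥ 1 and let x ∈ ℝⁿ with x ≠ 0. The inversion map φ is Fréchet differentiable at x, its derivative is the linear map Dφ(x): ℝⁿ → ℝⁿ given by Dφ(x)(h) = h/‖x‖² − 2⟨x, h⟩·x/‖x‖⁴, and the operator norm of Dφ(x) equals 1/‖x‖². -/
open scoped RealInnerProductSpace

/-- The inversion map `φ(x) = x / ‖x‖²` is Fréchet differentiable at every `x ≠ 0`, with
derivative `h ↦ h/‖x‖² - 2⟪x, h⟫ • x/‖x‖⁴`, whose operator norm is `1/‖x‖²`. -/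
theorem stmt_2 (n : ℕ) (hn : 1 ≤ n) (x : EuclideanSpace ℝ (Fin n)) (hx : x ≠ 0) :
    ∃ D : EuclideanSpace ℝ (Fin n) →L[ℝ] EuclideanSpace ℝ (Fin n),
      HasFDerivAt (fun y : EuclideanSpace ℝ (Fin n) => (‖y‖ ^ 2)⁻¹ • y) D x ∧
      (∀ h : EuclideanSpace ℝ (Fin n),
        D h = (‖x‖ ^ 2)⁻¹ • h - ((2 * ⟪x, h⟫ / ‖x‖ ^ 4) • x)) ∧
      ‖D‖ = (‖x‖ ^ 2)⁻¹ := by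
  have hnorm : ‖x‖ ≠ 0 := norm_ne_zero_iff.2 hx
  have : Nontrivial (EuclideanSpace ℝ (Fin n)) := nontrivial_of_ne x 0 hx
  refine ⟨(‖x‖ ^ 2)⁻¹ • ((ℝ ∙ x)ᗮ.reflection.toContinuousLinearEquiv :
    EuclideanSpace ℝ (Fin n) →L[ℝ] EuclideanSpace ℝ (Fin n)), ?_, fun h ↦ ?_, ?_⟩
  · have hinv := EuclideanGeometry.hasFDerivAt_inversion (R := 1) hx
    have hfun : EuclideanGeometry.inversion (0 : EuclideanSpace ℝ (Fin n)) 1 =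
        fun y ↦ (‖y‖ ^ 2)⁻¹ • y := by
      ext1 y
      simp [EuclideanGeometry.inversion]
    rw [hfun] at hinv
    simpa using hinv
  · have hrefl : (ℝ ∙ x)ᗮ.reflection h = h - (2 * (⟪x, h⟫ / ‖x‖ ^ 2)) • x := by
      rw [Submodule.reflection_orthogonal_apply, Submodule.reflection_singleton_apply]
      simp [mul_smul, two_smul]
    change (‖x‖ ^ 2)⁻¹ • (ℝ ∙ x)ᗮ.reflection h = _
    rw [hrefl, smul_sub, smul_smul]
    congr 2
    field_simp
  · rw [norm_smul, norm_inv, norm_pow, norm_norm]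
    have hone : ‖((ℝ ∙ x)ᗮ.reflection.toContinuousLinearEquiv :
        EuclideanSpace ℝ (Fin n) →L[ℝ] EuclideanSpace ℝ (Fin n))‖ = 1 :=
      (ℝ ∙ x)ᗮ.reflection.toLinearIsometry.norm_toContinuousLinearMap
    rw [hone, mul_one]
end

section
/- Let n ≥ 1, ε > 0, and let γ: (0, ε) → ℝⁿ be a C¹ curve with ‖γ(r)‖ = r for all r ∈ (0, ε). Suppose that ‖γ'(r)‖ → 1 as r → 0⁺ and that γ(r)/r → v as r → 0⁺ for some v ∈ ℝⁿ. Then γ'(r) → v as r → 0⁺. -/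
open Filter Set
open scoped Topology

/-- A curve parametrized by its distance to the origin has radial velocity one. -/
theorem inner_deriv_eq_of_norm_eq_id {E : Type*} [NormedAddCommGroup E] [InnerProductSpace ℝ E]
    {γ : ℝ → E} {w : E} {r : ℝ} (hγ : HasDerivAt γ w r) (hnorm : ∀ᶠ t in 𝓝 r, ‖γ t‖ = t) :
    inner ℝ (γ r) w = r := by
  have h₁ : HasDerivAt (fun t => ‖γ t‖ ^ 2) (2 * inner ℝ (γ r) w) r := hγ.norm_sq
  have h₂ : HasDerivAt (fun t : ℝ => t ^ 2) (2 * inner ℝ (γ r) w) r :=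
    h₁.congr_of_eventuallyEq (hnorm.mono fun t ht => by simp only [ht])
  have h₃ := h₂.unique (hasDerivAt_pow 2 r)
  norm_num at h₃
  linarith

/-- The squared distance between the velocity and the radial direction of a curve parametrized by
its distance to the origin. -/
theorem norm_deriv_sub_inv_smul_sq {E : Type*} [NormedAddCommGroup E] [InnerProductSpace ℝ E]
    {γ : ℝ → E} {w : E} {r : ℝ} (hr : r ≠ 0) (hγ : HasDerivAt γ w r)
    (hnorm : ∀ᶠ t in 𝓝 r, ‖γ t‖ = t) :
    ‖w - r⁻¹ • γ r‖ ^ 2 = ‖w‖ ^ 2 - 1 := by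
  have h := inner_deriv_eq_of_norm_eq_id hγ hnorm
  rw [norm_sub_sq_real, real_inner_smul_right, real_inner_comm, h, norm_smul, hnorm.self_of_nhds,
    mul_pow, Real.norm_eq_abs, sq_abs]
  field_simp
  ring

/-- If `γ : (0, ε) → ℝⁿ` is a `C¹` curve with `‖γ(r)‖ = r`, `‖γ'(r)‖ → 1` and
`γ(r)/r → v` as `r → 0⁺`, then `γ'(r) → v` as `r → 0⁺`. -/
theorem stmt_4 (n : ℕ) (hn : 1 ≤ n) (ε : ℝ) (hε : 0 < ε)
    (γ γ' : ℝ → EuclideanSpace ℝ (Fin n))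
    (hderiv : ∀ r ∈ Ioo (0 : ℝ) ε, HasDerivAt γ (γ' r) r)
    (hcont : ContinuousOn γ' (Ioo (0 : ℝ) ε))
    (hnorm : ∀ r ∈ Ioo (0 : ℝ) ε, ‖γ r‖ = r)
    (v : EuclideanSpace ℝ (Fin n))
    (hlim1 : Tendsto (fun r => ‖γ' r‖) (𝓝[Ioo (0 : ℝ) ε] 0) (𝓝 1))
    (hlim2 : Tendsto (fun r => r⁻¹ • γ r) (𝓝[Ioo (0 : ℝ) ε] 0) (𝓝 v)) :
    Tendsto γ' (𝓝[Ioo (0 : ℝ) ε] 0) (𝓝 v) := by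
  have hsq : Tendsto (fun r => ‖γ' r - r⁻¹ • γ r‖ ^ 2) (𝓝[Ioo (0 : ℝ) ε] 0) (𝓝 0) := by
    have h : Tendsto (fun r => ‖γ' r‖ ^ 2 - 1) (𝓝[Ioo (0 : ℝ) ε] 0) (𝓝 0) := by
      simpa using (hlim1.pow 2).sub_const 1
    refine h.congr' ?_
    filter_upwards [self_mem_nhdsWithin] with r hr
    exact (norm_deriv_sub_inv_smul_sq hr.1.ne' (hderiv r hr)
      (eventually_of_mem (isOpen_Ioo.mem_nhds hr) hnorm)).symm
  have hsub : Tendsto (fun r => γ' r - r⁻¹ • γ r) (𝓝[Ioo (0 : ℝ) ε] 0) (𝓝 0) := by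
    rw [tendsto_zero_iff_norm_tendsto_zero]
    simpa [Real.sqrt_sq] using hsq.sqrt
  simpa using hsub.add hlim2
end

section
/- Let I = (a, b) be an open interval in ℝ and let g: I → ℝ be a function with g(t) > 0 for all t ∈ I. Assume that for every t ∈ I and every sequence (t_n) in I converging to t, if the sequence (g(t_n)) converges in ℝ then its limit is positive. Then there exists a continuous function h: I → ℝ such that 0 < h(t) ≤ g(t) for all t ∈ I. -/
open Filter Set
open scoped Topology

/-- A positive function whose convergent sequences of values have positive limits is locally
bounded below by a positive constant. -/
theorem exists_pos_eventually_le_of_tendsto_pos {X : Type*} [TopologicalSpace X]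
    [FirstCountableTopology X] {f : X → ℝ} {x : X} (hf : ∀ y, 0 < f y)
    (hlim : ∀ u : ℕ → X, Tendsto u atTop (𝓝 x) →
      ∀ L : ℝ, Tendsto (fun k => f (u k)) atTop (𝓝 L) → 0 < L) :
    ∃ c > 0, ∀ᶠ y in 𝓝 x, c ≤ f y := by
  by_contra! h
  obtain ⟨s, hs⟩ := (𝓝 x).exists_antitone_basis
  have hex : ∀ n : ℕ, ∃ y ∈ s n, f y < 1 / ((n : ℝ) + 1) := fun n => by
    obtain ⟨y, hy, hys⟩ := ((h (1 / ((n : ℝ) + 1)) (by positivity)).and_eventually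
      (hs.mem n)).exists
    exact ⟨y, hys, hy⟩
  choose u hu hfu using hex
  exact lt_irrefl 0 <| hlim u (hs.tendsto hu) 0 <|
    squeeze_zero (fun k => (hf _).le) (fun k => (hfu k).le) tendsto_one_div_add_atTop_nhds_zero_nat

/-- If `g` is positive on the open interval `(a, b)` and every convergent sequence of
values `g(t_n)` (with `t_n` in the interval converging to a point of the interval) has
positive limit, then `g` admits a positive continuous lower bound on `(a, b)`. -/
theorem stmt_6 (a b : ℝ) (hab : a < b) (g : ℝ → ℝ)
    (hpos : ∀ t ∈ Ioo a b, 0 < g t)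
    (hlim : ∀ t ∈ Ioo a b, ∀ u : ℕ → ℝ, (∀ k, u k ∈ Ioo a b) →
      Tendsto u atTop (𝓝 t) → ∀ L : ℝ, Tendsto (fun k => g (u k)) atTop (𝓝 L) → 0 < L) :
    ∃ h : ℝ → ℝ, ContinuousOn h (Ioo a b) ∧ ∀ t ∈ Ioo a b, 0 < h t ∧ h t ≤ g t := by
  obtain ⟨f, hf⟩ := exists_continuous_forall_mem_convex_of_local_const
    (t := fun x : Ioo a b => Ioc 0 (g x)) (fun x => convex_Ioc 0 (g x)) fun x => by
      obtain ⟨c, hc, hle⟩ := exists_pos_eventually_le_of_tendsto_pos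
        (f := fun y : Ioo a b => g y) (x := x) (fun y => hpos y y.2) fun u hu =>
          hlim x x.2 (fun k => u k) (fun k => (u k).2) (tendsto_subtype_rng.1 hu)
      exact ⟨c, hle.mono fun y hy => ⟨hc, hy⟩⟩
  have hext : ∀ x : Ioo a b, Function.extend Subtype.val f 0 (x : ℝ) = f x :=
    Subtype.val_injective.extend_apply f 0
  refine ⟨Function.extend Subtype.val f 0, ?_, fun t ht => ?_⟩
  · rw [continuousOn_iff_continuous_domRestrict]
    exact f.continuous.congr fun x => (hext x).symm
  · rw [hext ⟨t, ht⟩]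
    exact hf ⟨t, ht⟩
end

section
/- Let n ≥ 1, let X be any subset of ℝⁿ \ {0}, let s ≥ 0, and let L ∈ [0, ∞]. Then the quotient μH^s(X ∩ S^{n-1}_r) / r^s tends to L as r → +∞ if and only if the quotient μH^s(φ(X) ∩ S^{n-1}_ρ) / ρ^s tends to L as ρ → 0⁺, where S^{n-1}_ρ denotes the sphere of radius ρ centered at the origin and φ is the inversion map. (This expresses that the density of X at infinity equals the density of φ(X) at the origin, up to normalizing constants.) -/
open MeasureTheory Metric Set Filter
open scoped ENNReal Topology

open scoped Pointwise in
/-- The part of the inverted set on the sphere of radius `ρ` is the homothetic copy with ratio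
`ρ ^ 2` of the part of the original set on the sphere of radius `ρ⁻¹`. -/
lemma inversion_image_inter_sphere {E : Type*} [NormedAddCommGroup E] [NormedSpace ℝ E]
    (X : Set E) (ρ : ℝ) :
    ((fun x : E => (‖x‖ ^ 2)⁻¹ • x) '' X) ∩ sphere (0 : E) ρ =
      (ρ ^ 2) • (X ∩ sphere (0 : E) ρ⁻¹) := by
  have norm_inversion (x : E) : ‖(‖x‖ ^ 2)⁻¹ • x‖ = ‖x‖⁻¹ := by
    rw [norm_smul, norm_inv, norm_pow, norm_norm]
    obtain h | h := eq_or_ne ‖x‖ 0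
    · simp [h]
    · field_simp
  ext y
  simp only [mem_inter_iff, mem_image, mem_sphere_zero_iff_norm, mem_smul_set]
  constructor
  · rintro ⟨⟨x, hx, rfl⟩, hy⟩
    rw [norm_inversion] at hy
    refine ⟨x, ⟨hx, by rw [← hy, inv_inv]⟩, ?_⟩
    rw [← hy, inv_pow]
  · rintro ⟨x, ⟨hx, hn⟩, rfl⟩
    have h : (‖x‖ ^ 2)⁻¹ = ρ ^ 2 := by rw [hn, inv_pow, inv_inv]
    refine ⟨⟨x, hx, by rw [h]⟩, ?_⟩
    rw [← h, norm_inversion, hn, inv_inv]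

/-- The normalized Hausdorff measure on spheres is exchanged by inversion. -/
lemma hausdorffMeasure_inversion_image_inter_sphere_div {E : Type*} [NormedAddCommGroup E]
    [NormedSpace ℝ E] [MeasurableSpace E] [BorelSpace E] (X : Set E) {s : ℝ} (hs : 0 ≤ s)
    {ρ : ℝ} (hρ : 0 < ρ) :
    μH[s] (((fun x : E => (‖x‖ ^ 2)⁻¹ • x) '' X) ∩ sphere (0 : E) ρ) / ENNReal.ofReal (ρ ^ s) =
      μH[s] (X ∩ sphere (0 : E) ρ⁻¹) / ENNReal.ofReal (ρ⁻¹ ^ s) := by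
  have hρs : 0 < ρ ^ s := Real.rpow_pos_of_pos hρ s
  have hc : ((‖ρ ^ 2‖₊ ^ s : NNReal) : ℝ≥0∞) =
      ENNReal.ofReal (ρ ^ s) * ENNReal.ofReal (ρ ^ s) := by
    rw [← ENNReal.ofReal_mul hρs.le, ← Real.mul_rpow hρ.le hρ.le, ← ENNReal.ofReal_coe_nnreal]
    congr 1
    rw [NNReal.coe_rpow, coe_nnnorm, Real.norm_of_nonneg (by positivity), pow_two]
  rw [inversion_image_inter_sphere X ρ, Measure.hausdorffMeasure_smul₀ hs (by positivity),
    ENNReal.smul_def, smul_eq_mul, hc, Real.inv_rpow hρ.le, ENNReal.ofReal_inv_of_pos hρs,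
    div_eq_mul_inv, div_eq_mul_inv, inv_inv, mul_comm (_ * _) (μH[s] _), ← mul_assoc,
    ENNReal.mul_inv_cancel_right (by simpa using hρs) ENNReal.ofReal_ne_top]

/-- For `X ⊆ ℝⁿ \ {0}`, the normalized `s`-dimensional Hausdorff measure of
`X ∩ S^{n-1}_r` tends to `L` as `r → +∞` if and only if the normalized measure of
`φ(X) ∩ S^{n-1}_ρ` tends to `L` as `ρ → 0⁺`, where `φ(x) = x/‖x‖²`: the density of `X`
at infinity equals the density of `φ(X)` at the origin. -/
theorem stmt_10 (n : ℕ) (hn : 1 ≤ n) (X : Set (EuclideanSpace ℝ (Fin n)))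
    (hX : X ⊆ {(0 : EuclideanSpace ℝ (Fin n))}ᶜ) (s : ℝ) (hs : 0 ≤ s) (L : ℝ≥0∞) :
    Tendsto (fun r : ℝ => μH[s] (X ∩ sphere (0 : EuclideanSpace ℝ (Fin n)) r) /
        ENNReal.ofReal (r ^ s)) atTop (𝓝 L)
      ↔ Tendsto (fun ρ : ℝ =>
          μH[s] (((fun x : EuclideanSpace ℝ (Fin n) => (‖x‖ ^ 2)⁻¹ • x) '' X) ∩
            sphere (0 : EuclideanSpace ℝ (Fin n)) ρ) / ENNReal.ofReal (ρ ^ s))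
          (𝓝[>] (0 : ℝ)) (𝓝 L) := by
  rw [← inv_nhdsGT_zero, ← Filter.map_inv, tendsto_map'_iff]
  refine tendsto_congr' ?_
  filter_upwards [self_mem_nhdsWithin] with ρ hρ
  exact (hausdorffMeasure_inversion_image_inter_sphere_div X hs hρ).symm
end
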